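/- Let G be a simple graph on n vertices (n even) with adjacency matrix A such that det W(G) = ±2^{n/2} and the constant term of the characteristic polynomial of G is ±1. Then for every integer m ≥ 2, the rooted product G∘P_m (a graph on mn vertices) satisfies det W(G∘P_m) = ±2^{mn/2} and the constant term of the characteristic polynomial of G∘P_m is ±1. -/

import Mathlib

open Polynomial Matrix Kronecker

/-- The walk matrix `[e, Me, M²e, …, M^{N-1}e]` of an `N × N` real matrix `M`. -/
noncomputable def walkMatrix {N : ℕ} (M : Matrix (Fin N) (Fin N) ℝ) :
    Matrix (Fin N) (Fin N) ℝ :=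
  Matrix.of fun i k => (M ^ (k : ℕ)).mulVec (fun _ => (1 : ℝ)) i

/-- The adjacency matrix of the path `P_m` on `m` vertices. -/
noncomputable def pathAdj (m : ℕ) : Matrix (Fin m) (Fin m) ℝ :=
  Matrix.of fun i j => if (i : ℕ) + 1 = (j : ℕ) ∨ (j : ℕ) + 1 = (i : ℕ) then 1 else 0

/-- The diagonal matrix `diag(1,0,…,0)`. -/
noncomputable def D1 (m : ℕ) : Matrix (Fin m) (Fin m) ℝ :=
  Matrix.of fun i j => if i = j ∧ (i : ℕ) = 0 then 1 else 0

section Krylov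

variable {R ι : Type*} [CommRing R] [Fintype ι] [DecidableEq ι]

/-- The Krylov matrix `[v, Bv, B²v, …]`, its columns being enumerated by `σ`. -/
def krylovMatrix {N : ℕ} (σ : ι ≃ Fin N) (B : Matrix ι ι R) (v : ι → R) : Matrix ι ι R :=
  Matrix.of fun i j => (B ^ (σ j : ℕ) *ᵥ v) i

theorem exists_krylovMatrix_mulVec_eq [Nontrivial R] {N : ℕ} (σ : ι ≃ Fin N) (B : Matrix ι ι R)
    (v : ι → R) (q : R[X]) : ∃ c, krylovMatrix σ B v *ᵥ c = aeval B q *ᵥ v := by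
  set r := q %ₘ B.charpoly with hr
  have hcard : Fintype.card ι = N := by simpa using Fintype.card_congr σ
  have hq : aeval B q = aeval B r := by
    conv_lhs => rw [← modByMonic_add_div q B.charpoly]
    simp [hr, aeval_self_charpoly]
  refine ⟨fun j => r.coeff (σ j), ?_⟩
  ext i
  have hN : 0 < N := (Nat.zero_le _).trans_lt (σ i).isLt
  have hdeg : r.natDegree < N := by
    have := degree_modByMonic_lt q B.charpoly_monic
    rw [charpoly_degree_eq_dim, hcard] at this
    by_cases h0 : r = 0
    · simpa [h0] using hN
    · exact (natDegree_lt_iff_degree_lt h0).2 this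
  rw [hq, aeval_eq_sum_range' hdeg, Matrix.sum_mulVec, Finset.sum_apply, Finset.sum_range]
  simp only [Matrix.mulVec, dotProduct, krylovMatrix, Matrix.of_apply]
  rw [← Equiv.sum_comp σ]
  refine Finset.sum_congr rfl fun j _ => ?_
  simp [Finset.mul_sum, mul_comm, mul_assoc]

theorem isUnit_aeval_of_dvd {p q : R[X]} (h : p ∣ q) {B : Matrix ι ι R}
    (hq : IsUnit (aeval B q)) : IsUnit (aeval B p) := by
  obtain ⟨r, rfl⟩ := h
  rw [Matrix.isUnit_iff_isUnit_det, map_mul, det_mul] at hq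
  exact (Matrix.isUnit_iff_isUnit_det _).2 (isUnit_of_mul_isUnit_left hq)

theorem det_dvd_det_of_mulVec (X Y : Matrix ι ι R) (h : ∀ j, ∃ c, Y *ᵥ c = X.col j) :
    Y.det ∣ X.det := by
  choose c hc using h
  have : X = Y * Matrix.of fun i j => c j i := by
    ext i j
    exact (congrFun (hc j) i).symm
  rw [this, det_mul]
  exact dvd_mul_right _ _

/-- The inverse of an invertible matrix is a polynomial in it. -/
theorem exists_aeval_mul_self_eq_one (u : Matrix ι ι R) (hu : IsUnit u) :
    ∃ q : R[X], aeval u q * u = 1 := by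
  have hdet : IsUnit u.det := (Matrix.isUnit_iff_isUnit_det u).1 hu
  rw [det_eq_sign_charpoly_coeff] at hdet
  obtain ⟨a, ha⟩ := (isUnit_of_mul_isUnit_right hdet).exists_left_inv
  refine ⟨C (-a) * u.charpoly.divX, ?_⟩
  have h := aeval_self_charpoly u
  rw [← divX_mul_X_add u.charpoly] at h
  simp only [map_add, map_mul, aeval_X, aeval_C] at h ⊢
  rw [mul_assoc, eq_neg_of_add_eq_zero_left h, mul_neg, ← map_mul, ← map_neg]
  simp [ha]

end Krylov

section Chebyshev

variable (R : Type*) [CommRing R]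

open Chebyshev

theorem chebyshev_S_sq_sub (k : ℤ) : S R k ^ 2 - S R (k + 1) * S R (k - 1) = 1 := by
  rw [S_sub_one]
  linear_combination S_sq_add_S_sq R k

theorem X_dvd_chebyshev_S_odd (h : ℕ) : X ∣ S R (2 * h + 1) := by
  induction h with
  | zero => simp
  | succ h ih =>
    push_cast
    rw [show (2 * ((h : ℤ) + 1) + 1) = 2 * h + 1 + 2 by ring, S_add_two]
    exact dvd_sub (dvd_mul_right _ _) ih

theorem chebyshev_S_double (h : ℕ) :
    S R (2 * h) = S R h ^ 2 - S R (h - 1) ^ 2 ∧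
    S R (2 * h - 1) = S R (h - 1) * (2 * S R h - X * S R (h - 1)) ∧
    ∑ k ∈ Finset.range (2 * h), S R k = S R (h - 1) * (S R h + S R (h - 1)) := by
  induction h with
  | zero => simp
  | succ h ih =>
    obtain ⟨h1, h2, h3⟩ := ih
    have e0 := S_add_one R h
    have e1 := S_add_one R (2 * h)
    have e2 := S_add_two R (2 * h)
    rw [show 2 * (h + 1) = 2 * h + 1 + 1 by ring, Finset.sum_range_succ, Finset.sum_range_succ, h3]
    push_cast
    rw [show (2 * ((h : ℤ) + 1)) = 2 * h + 2 by ring,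
      show (2 * (h : ℤ) + 2 - 1) = 2 * h + 1 by ring, show (h : ℤ) + 1 - 1 = h by ring, e2, e1, e0,
      h1, h2]
    refine ⟨by ring, by ring, by ring⟩

theorem sum_chebyshev_S_dvd (m : ℕ) :
    ∑ k ∈ Finset.range m, S R k ∣ S R m * S R (m - 1) := by
  obtain ⟨h, rfl | rfl⟩ := m.even_or_odd'
  · obtain ⟨h1, h2, h3⟩ := chebyshev_S_double R h
    push_cast
    rw [h1, h2, h3]
    exact ⟨(S R h - S R (h - 1)) * (2 * S R h - X * S R (h - 1)), by ring⟩
  · obtain ⟨h1, h2, h3⟩ := chebyshev_S_double R h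
    have e1 := S_add_one R (2 * h)
    push_cast
    rw [Finset.sum_range_succ, h3, show (2 * (h : ℤ) + 1 - 1) = 2 * h by ring, e1]
    push_cast
    rw [h1, h2]
    exact ⟨(S R h - S R (h - 1)) * (X * S R h - 2 * S R (h - 1)), by ring⟩

end Chebyshev

section RootedProduct

variable {R : Type*} [CommRing R] {n : ℕ}

/-- The adjacency matrix of a path over a commutative ring. -/
def pathMatrix (R : Type*) [CommRing R] (m : ℕ) : Matrix (Fin m) (Fin m) R :=
  Matrix.of fun i j => if (i : ℕ) + 1 = (j : ℕ) ∨ (j : ℕ) + 1 = (i : ℕ) then 1 else 0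

/-- The matrix `diag(1,0,…,0)` over a commutative ring. -/
def rootMatrix (R : Type*) [CommRing R] (m : ℕ) : Matrix (Fin m) (Fin m) R :=
  Matrix.of fun i j => if i = j ∧ (i : ℕ) = 0 then 1 else 0

/-- The matrix of the rooted product with a path. -/
def rootedMatrix (m : ℕ) (A : Matrix (Fin n) (Fin n) R) :
    Matrix (Fin m × Fin n) (Fin m × Fin n) R :=
  pathMatrix R m ⊗ₖ (1 : Matrix (Fin n) (Fin n) R) + rootMatrix R m ⊗ₖ A

/-- The tensor product of two vectors. -/
def tensorVec {ι κ : Type*} (u : ι → R) (w : κ → R) : ι × κ → R := fun p => u p.1 * w p.2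

theorem kronecker_mulVec_tensorVec {ι κ : Type*} [Fintype ι] [Fintype κ] (P : Matrix ι ι R)
    (Q : Matrix κ κ R) (u : ι → R) (w : κ → R) :
    (P ⊗ₖ Q) *ᵥ tensorVec u w = tensorVec (P *ᵥ u) (Q *ᵥ w) := by
  ext ⟨i, a⟩
  simp only [Matrix.mulVec, dotProduct, tensorVec, Fintype.sum_prod_type, kroneckerMap_apply,
    Finset.sum_mul_sum]
  exact Finset.sum_congr rfl fun _ _ => Finset.sum_congr rfl fun _ _ => by ring

/-- The indicator of the vertex of a path at distance `k` from the endvertex opposite to the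
root. -/
def leafDist (R : Type*) [CommRing R] (m : ℕ) (k : ℤ) : Fin m → R :=
  fun i => if (i : ℤ) + k + 1 = m then 1 else 0

theorem leafDist_eq_single {m k : ℕ} (i : Fin m) (h : i + k + 1 = m) :
    leafDist R m k = Pi.single i 1 := by
  ext j
  have : (j : ℤ) + k + 1 = m ↔ j = i := by
    rw [Fin.ext_iff]
    omega
  simp only [leafDist, this, Pi.single_apply]

theorem mulVec_leafDist {m k : ℕ} (hk : k < m) (P : Matrix (Fin m) (Fin m) R) (i : Fin m) :
    (P *ᵥ leafDist R m k) i = P i ⟨m - 1 - k, by omega⟩ := by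
  rw [leafDist_eq_single ⟨m - 1 - k, by omega⟩ (by simp; omega), Matrix.mulVec_single_one]
  rfl

theorem pathMatrix_mulVec_leafDist {m k : ℕ} (hk : k < m) :
    pathMatrix R m *ᵥ leafDist R m k = leafDist R m (k + 1) + leafDist R m (k - 1) := by
  ext i
  rw [mulVec_leafDist hk]
  have := i.isLt
  simp only [pathMatrix, leafDist, Matrix.of_apply, Pi.add_apply]
  split_ifs <;> first | omega | simp

theorem rootMatrix_mulVec_leafDist {m k : ℕ} (hk : k < m) :
    rootMatrix R m *ᵥ leafDist R m k = if k + 1 = m then leafDist R m k else 0 := by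
  ext i
  rw [mulVec_leafDist hk]
  have := i.isLt
  simp only [rootMatrix, Matrix.of_apply, Fin.ext_iff, apply_ite (fun f : Fin m → R => f i),
    Pi.zero_apply, leafDist]
  split_ifs <;> first | omega | rfl

theorem rootedMatrix_mulVec_of_lt {m k : ℕ} (hk : k + 1 < m) (A : Matrix (Fin n) (Fin n) R)
    (w : Fin n → R) :
    rootedMatrix m A *ᵥ tensorVec (leafDist R m k) w =
      tensorVec (leafDist R m (k + 1)) w + tensorVec (leafDist R m (k - 1)) w := by
  rw [rootedMatrix, Matrix.add_mulVec, kronecker_mulVec_tensorVec, kronecker_mulVec_tensorVec,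
    pathMatrix_mulVec_leafDist (by omega), rootMatrix_mulVec_leafDist (by omega), if_neg (by omega)]
  ext
  simp [tensorVec, add_mul]

theorem rootedMatrix_mulVec_root (m : ℕ) (A : Matrix (Fin n) (Fin n) R) (w : Fin n → R) :
    rootedMatrix (m + 1) A *ᵥ tensorVec (leafDist R (m + 1) m) w =
      tensorVec (leafDist R (m + 1) (m - 1)) w + tensorVec (leafDist R (m + 1) m) (A *ᵥ w) := by
  rw [rootedMatrix, Matrix.add_mulVec, kronecker_mulVec_tensorVec, kronecker_mulVec_tensorVec,
    pathMatrix_mulVec_leafDist (by omega), rootMatrix_mulVec_leafDist (by omega), if_pos rfl]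
  ext p
  have : leafDist R (m + 1) (m + 1) p.1 = 0 := if_neg (by push_cast; omega)
  simp [tensorVec, this]

open Chebyshev

theorem aeval_S_mulVec_leaf {m : ℕ} (A : Matrix (Fin n) (Fin n) R) (w : Fin n → R) (k : ℕ)
    (hk : k < m) :
    aeval (rootedMatrix m A) (S R k) *ᵥ tensorVec (leafDist R m 0) w =
      tensorVec (leafDist R m k) w := by
  induction k using Nat.strong_induction_on with
  | _ k ih =>
    match k with
    | 0 => simp
    | 1 =>
      have h := rootedMatrix_mulVec_of_lt (k := 0) (by omega) A w
      have h0 : leafDist R m (-1) = 0 := by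
        ext i
        exact if_neg (by have := i.isLt; omega)
      ext p
      simp_all [tensorVec]
    | k + 2 =>
      have h := rootedMatrix_mulVec_of_lt (k := k + 1) (by omega) A w
      push_cast
      rw [S_add_two, map_sub, map_mul, aeval_X, Matrix.sub_mulVec, ← Matrix.mulVec_mulVec]
      have h1 := ih (k + 1) (by omega) (by omega)
      have h2 := ih k (by omega) (by omega)
      push_cast at h h1
      rw [h1, h2, h, show (k : ℤ) + 1 - 1 = k by ring, show (k : ℤ) + 1 + 1 = k + 2 by ring,
        add_sub_cancel_right]

theorem aeval_S_length_mulVec_leaf (m : ℕ) (A : Matrix (Fin n) (Fin n) R) (w : Fin n → R) :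
    aeval (rootedMatrix (m + 1) A) (S R (m + 1)) *ᵥ tensorVec (leafDist R (m + 1) 0) w =
      tensorVec (leafDist R (m + 1) m) (A *ᵥ w) := by
  have h := rootedMatrix_mulVec_root m A w
  have h1 := aeval_S_mulVec_leaf A w m (Nat.lt_succ_self m)
  rw [S_add_one, map_sub, map_mul, aeval_X, Matrix.sub_mulVec, ← Matrix.mulVec_mulVec, h1, h]
  rcases m with _ | m
  · have h0 : leafDist R 1 (-1) = 0 := by
      ext i
      exact if_neg (by have := i.isLt; omega)
    ext p
    simp [h0, tensorVec]
  · have h2 := aeval_S_mulVec_leaf A w (m := m + 1 + 1) m (by omega)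
    push_cast
    rw [add_sub_cancel_right, h2, add_sub_cancel_left]

theorem commute_one_kronecker_rootedMatrix (m : ℕ) (A : Matrix (Fin n) (Fin n) R) :
    Commute ((1 : Matrix (Fin m) (Fin m) R) ⊗ₖ A) (rootedMatrix m A) := by
  simp [Commute, SemiconjBy, rootedMatrix, mul_add, add_mul, ← Matrix.mul_kronecker_mul]

theorem commute_one_kronecker_aeval (m : ℕ) (A : Matrix (Fin n) (Fin n) R) (q : R[X]) :
    Commute ((1 : Matrix (Fin m) (Fin m) R) ⊗ₖ A) (aeval (rootedMatrix m A) q) := by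
  induction q using Polynomial.induction_on' with
  | add p q hp hq => simpa using hp.add_right hq
  | monomial k a =>
    rw [aeval_monomial]
    exact (Algebra.commute_algebraMap_right a _).mul_right
      ((commute_one_kronecker_rootedMatrix m A).pow_right k)

theorem matrix_ext_tensorVec_leafDist {m : ℕ} {X Y : Matrix (Fin m × Fin n) (Fin m × Fin n) R}
    (h : ∀ k < m, ∀ w : Fin n → R, X *ᵥ tensorVec (leafDist R m (k : ℕ)) w =
      Y *ᵥ tensorVec (leafDist R m (k : ℕ)) w) : X = Y := by
  refine Matrix.ext_of_mulVec_single fun ⟨i, a⟩ => ?_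
  have hi := i.isLt
  have : Pi.single (i, a) 1 =
      tensorVec (leafDist R m ((m - 1 - i : ℕ) : ℤ)) (Pi.single a 1 : Fin n → R) := by
    rw [leafDist_eq_single i (by omega)]
    ext ⟨j, b⟩
    by_cases h1 : j = i <;> by_cases h2 : b = a <;> simp [tensorVec, h1, h2]
  rw [this]
  exact h _ (by omega) _

/-- The Cayley–Hamilton relation for the rooted product, the entries being polynomials in `A`. -/
theorem one_kronecker_mul_aeval_S (m : ℕ) (A : Matrix (Fin n) (Fin n) R) :
    ((1 : Matrix (Fin (m + 1)) (Fin (m + 1)) R) ⊗ₖ A) * aeval (rootedMatrix (m + 1) A) (S R m) =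
      aeval (rootedMatrix (m + 1) A) (S R (m + 1)) := by
  refine matrix_ext_tensorVec_leafDist fun k hk w => ?_
  have hleaf : ((1 : Matrix (Fin (m + 1)) (Fin (m + 1)) R) ⊗ₖ A) *ᵥ
      (aeval (rootedMatrix (m + 1) A) (S R m) *ᵥ tensorVec (leafDist R (m + 1) 0) w) =
      aeval (rootedMatrix (m + 1) A) (S R (m + 1)) *ᵥ tensorVec (leafDist R (m + 1) 0) w := by
    rw [aeval_S_mulVec_leaf A w m (by omega), aeval_S_length_mulVec_leaf,
      kronecker_mulVec_tensorVec, Matrix.one_mulVec]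
  have hcomm (p q : R[X]) : Commute (aeval (rootedMatrix (m + 1) A) p)
      (aeval (rootedMatrix (m + 1) A) q) := by
    rw [Commute, SemiconjBy, ← map_mul, ← map_mul, mul_comm]
  rw [← aeval_S_mulVec_leaf A w k hk, Matrix.mulVec_mulVec, Matrix.mulVec_mulVec,
    ← (hcomm (S R k) (S R (m + 1))).eq, mul_assoc, ← (hcomm (S R k) (S R m)).eq, ← mul_assoc,
    (commute_one_kronecker_aeval (m + 1) A (S R k)).eq, mul_assoc]
  simp only [← Matrix.mulVec_mulVec, hleaf]

theorem isUnit_aeval_S (m : ℕ) (A : Matrix (Fin n) (Fin n) R) :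
    IsUnit (aeval (rootedMatrix (m + 1) A) (S R m)) := by
  set T := rootedMatrix (m + 1) A
  have h := congrArg (aeval T) (chebyshev_S_sq_sub R m)
  rw [map_sub, map_mul, map_pow, map_one, ← one_kronecker_mul_aeval_S,
    (commute_one_kronecker_aeval (m + 1) A (S R m)).eq, sq, mul_assoc, ← mul_sub] at h
  exact IsUnit.of_mul_eq_one _ h

theorem isUnit_one_kronecker (m : ℕ) {A : Matrix (Fin n) (Fin n) R} (hA : IsUnit A.det) :
    IsUnit ((1 : Matrix (Fin m) (Fin m) R) ⊗ₖ A) := by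
  rw [Matrix.isUnit_iff_isUnit_det, Matrix.det_kronecker]
  simpa using hA.pow m

theorem isUnit_aeval_S_length (m : ℕ) {A : Matrix (Fin n) (Fin n) R} (hA : IsUnit A.det) :
    IsUnit (aeval (rootedMatrix (m + 1) A) (S R (m + 1))) := by
  rw [← one_kronecker_mul_aeval_S]
  exact (isUnit_one_kronecker _ hA).mul (isUnit_aeval_S m A)

theorem isUnit_aeval_sum_S (m : ℕ) {A : Matrix (Fin n) (Fin n) R} (hA : IsUnit A.det) :
    IsUnit (aeval (rootedMatrix (m + 1) A) (∑ k ∈ Finset.range (m + 1), S R k)) := by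
  have h := (isUnit_aeval_S_length m hA).mul (isUnit_aeval_S m A)
  have hdvd := sum_chebyshev_S_dvd R (m + 1)
  push_cast at hdvd
  rw [add_sub_cancel_right] at hdvd
  rw [← map_mul] at h
  exact isUnit_aeval_of_dvd hdvd h

theorem isUnit_det_rootedMatrix (m : ℕ) {A : Matrix (Fin n) (Fin n) R} (hA : IsUnit A.det) :
    IsUnit (rootedMatrix (m + 1) A).det := by
  rw [← Matrix.isUnit_iff_isUnit_det, ← aeval_X (R := R) (rootedMatrix (m + 1) A)]
  obtain ⟨h, rfl | rfl⟩ := m.even_or_odd'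
  · refine isUnit_aeval_of_dvd (X_dvd_chebyshev_S_odd R h) ?_
    exact_mod_cast isUnit_aeval_S_length (2 * h) hA
  · refine isUnit_aeval_of_dvd (X_dvd_chebyshev_S_odd R h) ?_
    exact_mod_cast isUnit_aeval_S (2 * h + 1) A

theorem sum_leafDist (m : ℕ) : ∑ k ∈ Finset.range m, leafDist R m (k : ℕ) = 1 := by
  ext i
  have hi := i.isLt
  rw [Finset.sum_apply, Finset.sum_eq_single (m - 1 - i)]
  · exact if_pos (by omega)
  · intro k _ hk
    exact if_neg (by omega)
  · simp
    omega

theorem aeval_sum_S_mulVec_leaf (m : ℕ) (A : Matrix (Fin n) (Fin n) R) (w : Fin n → R) :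
    aeval (rootedMatrix m A) (∑ k ∈ Finset.range m, S R k) *ᵥ tensorVec (leafDist R m 0) w =
      tensorVec 1 w := by
  rw [map_sum, Matrix.sum_mulVec,
    Finset.sum_congr rfl fun k hk => aeval_S_mulVec_leaf A w k (Finset.mem_range.1 hk),
    ← sum_leafDist]
  ext p
  simp [tensorVec, Finset.sum_mul]

theorem exists_aeval_eq_one_kronecker (m : ℕ) (A : Matrix (Fin n) (Fin n) R) :
    ∃ q : R[X], aeval (rootedMatrix (m + 1) A) q =
      (1 : Matrix (Fin (m + 1)) (Fin (m + 1)) R) ⊗ₖ A := by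
  obtain ⟨q, hq⟩ := exists_aeval_mul_self_eq_one _ (isUnit_aeval_S m A)
  rw [mul_eq_one_comm, ← aeval_comp] at hq
  refine ⟨S R (m + 1) * q.comp (S R m), ?_⟩
  rw [map_mul, ← one_kronecker_mul_aeval_S, mul_assoc, hq, mul_one]

theorem exists_aeval_mulVec_one (m : ℕ) {A : Matrix (Fin n) (Fin n) R} (hA : IsUnit A.det)
    (w : Fin n → R) (j : ℕ) (k : ℕ) (hk : k < m + 1) :
    ∃ q : R[X], aeval (rootedMatrix (m + 1) A) q *ᵥ tensorVec 1 w =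
      tensorVec (leafDist R (m + 1) k) (A ^ j *ᵥ w) := by
  obtain ⟨t, ht⟩ := exists_aeval_eq_one_kronecker m A
  obtain ⟨q, hq⟩ := exists_aeval_mul_self_eq_one _ (isUnit_aeval_sum_S m hA)
  rw [← aeval_comp] at hq
  refine ⟨t ^ j * S R k * q.comp (∑ k ∈ Finset.range (m + 1), S R k), ?_⟩
  rw [← aeval_sum_S_mulVec_leaf (m + 1) A w, Matrix.mulVec_mulVec, map_mul, mul_assoc, hq, mul_one,
    map_mul, ← Matrix.mulVec_mulVec, aeval_S_mulVec_leaf A w k hk, map_pow, ht]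
  clear hq ht
  induction j with
  | zero => simp
  | succ j ih =>
    rw [pow_succ', ← Matrix.mulVec_mulVec, ih, kronecker_mulVec_tensorVec, Matrix.one_mulVec,
      Matrix.mulVec_mulVec, ← pow_succ']

theorem one_kronecker_mulVec {ι κ : Type*} [Fintype ι] [Fintype κ] [DecidableEq ι]
    (Q : Matrix κ κ R) (v : ι × κ → R) (p : ι × κ) :
    (((1 : Matrix ι ι R) ⊗ₖ Q) *ᵥ v) p = (Q *ᵥ fun a => v (p.1, a)) p.2 := by
  simp [Matrix.mulVec, dotProduct, Fintype.sum_prod_type, kroneckerMap_apply, Matrix.one_apply]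

theorem rootedMatrix_pow_mulVec_block (m : ℕ) (A : Matrix (Fin n) (Fin n) R) (w : Fin n → R)
    (k : ℕ) (i : Fin m) :
    ∃ q : R[X], (fun a => (rootedMatrix m A ^ k *ᵥ tensorVec 1 w) (i, a)) = aeval A q *ᵥ w := by
  induction k generalizing i with
  | zero =>
    refine ⟨1, ?_⟩
    ext a
    simp [tensorVec]
  | succ k ih =>
    choose q hq using ih
    refine ⟨∑ j, (pathMatrix R m i j • q j + rootMatrix R m i j • (X * q j)), ?_⟩
    have hq' : rootedMatrix m A ^ k *ᵥ tensorVec 1 w = fun p => (aeval A (q p.1) *ᵥ w) p.2 := by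
      ext ⟨j, a⟩
      exact congrFun (hq j) a
    rw [pow_succ', ← Matrix.mulVec_mulVec, hq']
    ext a
    simp only [map_sum, map_add, map_smul, map_mul, aeval_X, Matrix.sum_mulVec, Finset.sum_apply,
      Matrix.add_mulVec, ← Matrix.mulVec_mulVec, Pi.add_apply, Matrix.smul_mulVec,
      Pi.smul_apply, smul_eq_mul]
    simp only [rootedMatrix, Matrix.add_mulVec, Pi.add_apply]
    rw [Finset.sum_add_distrib]
    congr 1
    · rw [Matrix.mulVec, dotProduct, Fintype.sum_prod_type]
      simp [kroneckerMap_apply, Matrix.one_apply]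
    · rw [Matrix.mulVec, dotProduct, Fintype.sum_prod_type]
      simp [kroneckerMap_apply, Matrix.mulVec, dotProduct, Finset.mul_sum, mul_assoc]

theorem associated_det_krylovMatrix_rootedMatrix [IsDomain R] (m : ℕ)
    {A : Matrix (Fin n) (Fin n) R} (hA : IsUnit A.det) (w : Fin n → R) :
    Associated (krylovMatrix finProdFinEquiv (rootedMatrix (m + 1) A) (tensorVec 1 w)).det
      ((krylovMatrix (Equiv.refl _) A w).det ^ (m + 1)) := by
  have hdet : ((1 : Matrix (Fin (m + 1)) (Fin (m + 1)) R) ⊗ₖ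
      krylovMatrix (Equiv.refl _) A w).det = (krylovMatrix (Equiv.refl _) A w).det ^ (m + 1) := by
    simp [Matrix.det_kronecker]
  rw [← hdet]
  refine associated_of_dvd_dvd (det_dvd_det_of_mulVec _ _ ?_) (det_dvd_det_of_mulVec _ _ ?_)
  · rintro ⟨i, j⟩
    have hi := i.isLt
    obtain ⟨q, hq⟩ := exists_aeval_mulVec_one m hA w j (m - i) (by omega)
    obtain ⟨c, hc⟩ := exists_krylovMatrix_mulVec_eq finProdFinEquiv (rootedMatrix (m + 1) A)
      (tensorVec 1 w) q
    refine ⟨c, ?_⟩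
    rw [hc, hq]
    rw [leafDist_eq_single i (by omega)]
    ext ⟨i', a⟩
    simp [tensorVec, krylovMatrix, Matrix.one_apply, Pi.single_apply]
  · intro j
    choose q hq using rootedMatrix_pow_mulVec_block (m + 1) A w (finProdFinEquiv j)
    choose c hc using fun i => exists_krylovMatrix_mulVec_eq (Equiv.refl _) A w (q i)
    refine ⟨fun p => c p.1 p.2, ?_⟩
    ext ⟨i, a⟩
    rw [one_kronecker_mulVec]
    exact (congrFun (hc i) a).trans (congrFun (hq i) a).symm

end RootedProduct

section Cast

theorem walkMatrix_map_intCast {N : ℕ} (A : Matrix (Fin N) (Fin N) ℤ) :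
    walkMatrix (A.map (Int.cast : ℤ → ℝ)) =
      (krylovMatrix (Equiv.refl _) A 1).map (Int.cast : ℤ → ℝ) := by
  ext i j
  have h := RingHom.map_mulVec (Int.castRingHom ℝ) (A ^ (j : ℕ)) 1 i
  rw [← RingHom.mapMatrix_apply, map_pow] at h
  simpa [walkMatrix, krylovMatrix, Function.comp_def] using h.symm

theorem krylovMatrix_reindex {R ι κ : Type*} [CommRing R] [Fintype ι] [DecidableEq ι] [Fintype κ]
    [DecidableEq κ] {N : ℕ} (e : ι ≃ κ) (σ : κ ≃ Fin N) (B : Matrix ι ι R) (v : κ → R) :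
    krylovMatrix σ (Matrix.reindex e e B) v =
      Matrix.reindex e e (krylovMatrix (e.trans σ) B (v ∘ e)) := by
  ext i j
  have h : Matrix.reindex e e B ^ (σ j : ℕ) = Matrix.reindex e e (B ^ (σ j : ℕ)) :=
    (map_pow (Matrix.reindexAlgEquiv R R e) B (σ j)).symm
  rw [krylovMatrix, Matrix.of_apply, h, Matrix.reindex_apply, Matrix.submatrix_mulVec_equiv]
  simp [krylovMatrix]

theorem reindex_kronecker_map_intCast {n : ℕ} (m : ℕ) (A : Matrix (Fin n) (Fin n) ℤ) :
    Matrix.reindex finProdFinEquiv finProdFinEquiv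
      (pathAdj m ⊗ₖ (1 : Matrix (Fin n) (Fin n) ℝ) + D1 m ⊗ₖ A.map (Int.cast : ℤ → ℝ)) =
    (Matrix.reindex finProdFinEquiv finProdFinEquiv (rootedMatrix m A)).map
      (Int.cast : ℤ → ℝ) := by
  have hpath (a b : Fin m) : pathAdj m a b = pathMatrix ℤ m a b := by
    rw [pathAdj, pathMatrix, Matrix.of_apply, Matrix.of_apply]
    push_cast
    rfl
  have hroot (a b : Fin m) : D1 m a b = rootMatrix ℤ m a b := by
    rw [D1, rootMatrix, Matrix.of_apply, Matrix.of_apply]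
    push_cast
    rfl
  ext i j
  simp [rootedMatrix, hpath, hroot, Matrix.one_apply, kroneckerMap_apply]

theorem charpoly_coeff_zero_eq_one_or_neg_one_iff {N : ℕ} (A : Matrix (Fin N) (Fin N) ℤ) :
    ((A.map (Int.cast : ℤ → ℝ)).charpoly.coeff 0 = 1 ∨
      (A.map (Int.cast : ℤ → ℝ)).charpoly.coeff 0 = -1) ↔ IsUnit A.det := by
  have h : (A.map (Int.cast : ℤ → ℝ)).charpoly.coeff 0 = ((A.charpoly.coeff 0 : ℤ) : ℝ) := by
    have := Matrix.charpoly_map A (Int.castRingHom ℝ)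
    simpa using congrArg (coeff · 0) this
  rw [h, det_eq_sign_charpoly_coeff, IsUnit.mul_iff, and_iff_right (IsUnit.pow _ (by simp)),
    Int.isUnit_iff]
  norm_cast

end Cast

theorem rooted_product_in_family {n : ℕ} (hn : Even n)
    (A : Matrix (Fin n) (Fin n) ℝ) (hsym : A.IsSymm)
    (h01 : ∀ i j, A i j = 0 ∨ A i j = 1) (hdiag : ∀ i, A i i = 0)
    (hW : (walkMatrix A).det = 2 ^ (n / 2) ∨ (walkMatrix A).det = -2 ^ (n / 2))
    (ha0 : A.charpoly.coeff 0 = 1 ∨ A.charpoly.coeff 0 = -1)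
    (m : ℕ) (hm : 2 ≤ m)
    (Atil : Matrix (Fin (m * n)) (Fin (m * n)) ℝ)
    (hAtil : Atil = Matrix.reindex finProdFinEquiv finProdFinEquiv
      (pathAdj m ⊗ₖ (1 : Matrix (Fin n) (Fin n) ℝ) + D1 m ⊗ₖ A)) :
    ((walkMatrix Atil).det = 2 ^ (m * n / 2) ∨
      (walkMatrix Atil).det = -2 ^ (m * n / 2)) ∧
    (Atil.charpoly.coeff 0 = 1 ∨ Atil.charpoly.coeff 0 = -1) := by
  obtain ⟨A, rfl⟩ : ∃ A₀ : Matrix (Fin n) (Fin n) ℤ, A = A₀.map (Int.cast : ℤ → ℝ) := by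
    have h : ∀ i j, ∃ a : ℤ, A i j = a := fun i j =>
      (h01 i j).elim (fun h => ⟨0, by simpa using h⟩) fun h => ⟨1, by simpa using h⟩
    choose A₀ hA₀ using h
    exact ⟨Matrix.of A₀, Matrix.ext hA₀⟩
  obtain ⟨m, rfl⟩ : ∃ k, m = k + 1 := ⟨m - 1, by omega⟩
  rw [charpoly_coeff_zero_eq_one_or_neg_one_iff] at ha0
  rw [reindex_kronecker_map_intCast] at hAtil
  subst hAtil
  rw [charpoly_coeff_zero_eq_one_or_neg_one_iff, Matrix.det_reindex_self]
  refine ⟨?_, isUnit_det_rootedMatrix m ha0⟩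
  have hdet {N : ℕ} (B : Matrix (Fin N) (Fin N) ℤ) : (B.map (Int.cast : ℤ → ℝ)).det = B.det :=
    (Int.cast_det B).symm
  rw [walkMatrix_map_intCast, hdet] at hW ⊢
  have hassoc := associated_det_krylovMatrix_rootedMatrix m ha0 1
  have hone : tensorVec (1 : Fin (m + 1) → ℤ) (1 : Fin n → ℤ) = 1 := by
    ext
    simp [tensorVec]
  rw [krylovMatrix_reindex, Matrix.det_reindex_self, Equiv.trans_refl, Pi.one_comp]
  rw [hone] at hassoc
  obtain ⟨h, rfl⟩ := hn.two_dvd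
  rw [show (m + 1) * (2 * h) / 2 = h * (m + 1) by rw [mul_left_comm]; simp [mul_comm]]
  rw [Nat.mul_div_cancel_left h two_pos] at hW
  norm_cast at hW ⊢
  rw [← Int.associated_iff] at hW ⊢
  rw [pow_mul]
  exact hassoc.trans hW.pow_pow
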